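/- Let p ∈ (0,1) and let (G_t)_{t≥1} be the preferential attachment process with edge-steps with parameter p, set c_p = 1 − p/2 and φ(s) := ∏_{r=1}^{s−1} (1 + c_p/r). Then there exist positive constants C₁ and C₂, depending only on p, such that for every vertex index i ≥ 1 and every real λ > i^{−c_p}: P( sup_{s ∈ ℕ} d_s(i)/φ(s) > λ / i^{c_p} ) ≤ C₁ · exp(−C₂ λ). -/

import Mathlib

open MeasureTheory Filter

attribute [local instance] Classical.propDecidable

/-- Degree of vertex `i` at time `t` computed from the endpoint process `ep`:
the edge added at step `s` contributes `1` for each of its endpoints equal to `i`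
(so a loop at `i` contributes `2`). -/
noncomputable def degOf {Ω : Type} (ep : ℕ → Ω → ℕ × ℕ) (t i : ℕ) (ω : Ω) : ℕ :=
  ∑ s ∈ Finset.Icc 1 t,
    ((if (ep s ω).1 = i then 1 else 0) + (if (ep s ω).2 = i then 1 else 0))

/-- The preferential attachment random graph process with edge-steps and parameter `p`.
`G_1` is a single vertex (labeled `1`) with a loop.  At each step `t + 1` (for `t ≥ 1`),
with probability `p` a vertex-step occurs: a new vertex `nv t + 1` is added together with an
edge to an old vertex `u`, chosen with probability `d_t(u) / (2t)`; with probability `1 - p`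
an edge-step occurs: an edge `{u, w}` is added, where `u` and `w` are chosen independently,
each with probability proportional to its degree.  The field `ep t` records the (ordered pair
of) endpoints of the unique edge added at step `t`, `nv t` is the number of vertices of `G_t`,
and `Z t` tells whether step `t` was a vertex-step.  The one-step conditional laws are
prescribed via conditional expectations with respect to a filtration `ℱ` to which the process
is adapted. -/
structure PAProcess (p : ℝ) where
  Ω : Type
  m0 : MeasurableSpace Ω
  μ : Measure Ω
  isProb : IsProbabilityMeasure μ
  ℱ : Filtration ℕ m0
  Z : ℕ → Ω → Bool
  nv : ℕ → Ω → ℕ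
  ep : ℕ → Ω → ℕ × ℕ
  nv_one : ∀ ω, nv 1 ω = 1
  ep_one : ∀ ω, ep 1 ω = (1, 1)
  nv_succ : ∀ t, 1 ≤ t → ∀ ω, nv (t + 1) ω = nv t ω + (if Z (t + 1) ω then 1 else 0)
  ep_vertexStep : ∀ t, 1 ≤ t → ∀ ω, Z (t + 1) ω = true →
    (ep (t + 1) ω).2 = nv t ω + 1 ∧ 1 ≤ (ep (t + 1) ω).1 ∧ (ep (t + 1) ω).1 ≤ nv t ω
  ep_edgeStep : ∀ t, 1 ≤ t → ∀ ω, Z (t + 1) ω = false →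
    1 ≤ (ep (t + 1) ω).1 ∧ (ep (t + 1) ω).1 ≤ nv t ω ∧
    1 ≤ (ep (t + 1) ω).2 ∧ (ep (t + 1) ω).2 ≤ nv t ω
  Z_meas : ∀ t, Measurable[ℱ t] (Z t)
  nv_meas : ∀ t, Measurable[ℱ t] (nv t)
  ep_meas : ∀ t, Measurable[ℱ t] (ep t)
  condLaw_Z : ∀ t, 1 ≤ t →
    μ[Set.indicator {ω | Z (t + 1) ω = true} (fun _ => (1 : ℝ)) | ℱ t] =ᵐ[μ] fun _ => p
  condLaw_vertex : ∀ t, 1 ≤ t → ∀ u,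
    μ[Set.indicator {ω | Z (t + 1) ω = true ∧ ep (t + 1) ω = (u, nv t ω + 1)}
        (fun _ => (1 : ℝ)) | ℱ t]
      =ᵐ[μ] fun ω => p * (degOf ep t u ω : ℝ) / (2 * t)
  condLaw_edge : ∀ t, 1 ≤ t → ∀ u w,
    μ[Set.indicator {ω | Z (t + 1) ω = false ∧ ep (t + 1) ω = (u, w)}
        (fun _ => (1 : ℝ)) | ℱ t]
      =ᵐ[μ] fun ω => (1 - p) * (degOf ep t u ω : ℝ) * (degOf ep t w ω : ℝ) / (2 * t) ^ 2

namespace PAProcess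

variable {p : ℝ} (P : PAProcess p)

/-- degree `d_t(i)` of vertex `i` in `G_t` (`0` if `i` is not yet present). -/
noncomputable def deg (t i : ℕ) (ω : P.Ω) : ℕ := degOf P.ep t i ω

/-- `i` and `j` are joined by at least one edge in `G_t`. -/
def Joined (t i j : ℕ) (ω : P.Ω) : Prop :=
  ∃ s ∈ Finset.Icc 1 t, P.ep s ω = (i, j) ∨ P.ep s ω = (j, i)

/-- number of triangles of `G_t`: sets of three distinct vertices pairwise joined by at
least one edge (counted without edge multiplicities). -/
noncomputable def triangles (t : ℕ) (ω : P.Ω) : ℕ :=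
  ((Finset.Icc 1 t ×ˢ Finset.Icc 1 t ×ˢ Finset.Icc 1 t).filter
    (fun q => q.1 < q.2.1 ∧ q.2.1 < q.2.2 ∧ P.Joined t q.1 q.2.1 ω ∧
      P.Joined t q.1 q.2.2 ω ∧ P.Joined t q.2.1 q.2.2 ω)).card

/-- number of cherries (paths of length 2) of `G_t`: unordered pairs of distinct edges of
`G_t` sharing a common endpoint.  The edges of `G_t` are indexed by their creation times
`1 ≤ s ≤ t`. -/
noncomputable def cherries (t : ℕ) (ω : P.Ω) : ℕ :=
  ((Finset.Icc 1 t ×ˢ Finset.Icc 1 t).filter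
    (fun q => q.1 < q.2 ∧
      ((P.ep q.1 ω).1 = (P.ep q.2 ω).1 ∨ (P.ep q.1 ω).1 = (P.ep q.2 ω).2 ∨
       (P.ep q.1 ω).2 = (P.ep q.2 ω).1 ∨ (P.ep q.1 ω).2 = (P.ep q.2 ω).2))).card

/-- global clustering coefficient of `G_t`. -/
noncomputable def clustering (t : ℕ) (ω : P.Ω) : ℝ :=
  3 * (P.triangles t ω : ℝ) / (P.cherries t ω : ℝ)

/-- clique number of `G_t`: the largest `k` such that `G_t` contains `k` distinct vertices
pairwise joined by at least one edge. -/
noncomputable def cliqueNum (t : ℕ) (ω : P.Ω) : ℕ :=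
  sSup {k | ∃ S : Finset ℕ, S ⊆ Finset.Icc 1 (P.nv t ω) ∧ S.card = k ∧
    ∀ i ∈ S, ∀ j ∈ S, i ≠ j → P.Joined t i j ω}

/-- `Γ_t(j)`: the number of distinct vertices joined to `j` by at least one edge in `G_t`. -/
noncomputable def nbrCount (t j : ℕ) (ω : P.Ω) : ℕ :=
  ((Finset.Icc 1 t).filter (fun i => P.Joined t i j ω)).card

/-- the time at which vertex `j` is added to the graph. -/
noncomputable def addTime (j : ℕ) (ω : P.Ω) : ℕ := sInf {t | P.nv t ω = j}

/-- at step `s` an edge joining `i` and `j` is added by an edge-step. -/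
def EdgeStepEdge (s i j : ℕ) (ω : P.Ω) : Prop :=
  2 ≤ s ∧ P.Z s ω = false ∧ (P.ep s ω = (i, j) ∨ P.ep s ω = (j, i))

/-- at step `s` an edge joining `i` and `j` is added by a vertex-step. -/
def VertexStepEdge (s i j : ℕ) (ω : P.Ω) : Prop :=
  2 ≤ s ∧ P.Z s ω = true ∧ (P.ep s ω = (i, j) ∨ P.ep s ω = (j, i))

/-- at step `s` vertex `j` is added by a vertex-step and its attaching edge connects it
to vertex `i`. -/
def AttachEdge (s i j : ℕ) (ω : P.Ω) : Prop :=
  2 ≤ s ∧ P.Z s ω = true ∧ P.ep s ω = (i, j) ∧ P.nv s ω = j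

/-- `i` and `j` are joined in `G_t` by at least one edge created at an edge-step. -/
def EdgeJoined (t i j : ℕ) (ω : P.Ω) : Prop :=
  ∃ s ∈ Finset.Icc 1 t, P.EdgeStepEdge s i j ω

/-- `i` and `j` are joined in `G_t` by at least one edge created at a vertex-step. -/
def VJoined (t i j : ℕ) (ω : P.Ω) : Prop :=
  ∃ s ∈ Finset.Icc 1 t, P.VertexStepEdge s i j ω

/-- `i` and `j` are joined in `G_t`, and exclusively by edges created at vertex-steps. -/
def OnlyVertexJoined (t i j : ℕ) (ω : P.Ω) : Prop :=
  P.Joined t i j ω ∧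
    ∀ s ∈ Finset.Icc 1 t, (P.ep s ω = (i, j) ∨ P.ep s ω = (j, i)) → P.Z s ω = true

end PAProcess

/-- the normalizing factor `φ(t) = ∏_{s=1}^{t-1} (1 + c/s)`, with `φ(1) = 1`. -/
noncomputable def phi (c : ℝ) (t : ℕ) : ℝ := ∏ s ∈ Finset.Icc 1 (t - 1), (1 + c / (s : ℝ))

/-- The Ville maximal inequality on a window of times: if a nonnegative adapted process has
nonincreasing integrals over past events from time `i` on, the probability that it reaches the
level `θ` is at most its initial expectation divided by `θ`. -/
theorem mul_measureReal_exists_ge_le {Ω : Type*} {m0 : MeasurableSpace Ω} {μ : Measure Ω}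
    [IsProbabilityMeasure μ] (ℱ : Filtration ℕ m0) (N : ℕ → Ω → ℝ) (i : ℕ) (θ C : ℝ)
    (hmeas : ∀ n, i ≤ n → Measurable[ℱ n] (N n)) (hnn : ∀ n ω, 0 ≤ N n ω)
    (hint : ∀ n, i ≤ n → Integrable (N n) μ)
    (hstep : ∀ n, i ≤ n → ∀ A, MeasurableSet[ℱ n] A →
      ∫ ω in A, N (n + 1) ω ∂μ ≤ ∫ ω in A, N n ω ∂μ)
    (hC : ∫ ω, N i ω ∂μ ≤ C) (n : ℕ) (hn : i ≤ n) :
    θ * μ.real {ω | ∃ s, i ≤ s ∧ s < n ∧ θ ≤ N s ω} ≤ C := by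
  set H : ℕ → Set Ω := fun n => {ω | ∃ s, i ≤ s ∧ s < n ∧ θ ≤ N s ω} with hH
  have hHm : ∀ n, MeasurableSet[ℱ n] (H n) := by
    intro n
    have : H n = ⋃ s ∈ {s | i ≤ s ∧ s < n}, {ω | θ ≤ N s ω} := by
      ext ω; simp [hH, and_assoc]
    rw [this]
    refine MeasurableSet.biUnion (Set.to_countable _) fun s hs => ?_
    exact ℱ.mono hs.2.le _ (hmeas s hs.1 measurableSet_Ici)
  have key : ∀ n, i ≤ n → ∫ ω in (H n)ᶜ, N n ω ∂μ + θ * μ.real (H n) ≤ C := by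
    intro n hn
    induction n, hn using Nat.le_induction with
    | base =>
      have : H i = ∅ := by
        ext ω; refine iff_of_false ?_ (Set.notMem_empty ω)
        rintro ⟨s, h1, h2, -⟩; omega
      simpa [this] using hC
    | succ n hn ih =>
      set B : Set Ω := {ω | θ ≤ N n ω} with hB
      have hBm : MeasurableSet[ℱ n] B :=
        hmeas n hn measurableSet_Ici
      have hsucc : H (n + 1) = H n ∪ ((H n)ᶜ ∩ B) := by
        ext ω
        constructor
        · rintro ⟨s, h1, h2, h3⟩
          by_cases hlt : ∃ s, i ≤ s ∧ s < n ∧ θ ≤ N s ω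
          · exact Or.inl hlt
          · refine Or.inr ⟨hlt, ?_⟩
            rcases Nat.lt_succ_iff_lt_or_eq.mp h2 with h | h
            · exact absurd ⟨s, h1, h, h3⟩ hlt
            · exact (h ▸ h3 : θ ≤ N n ω)
        · rintro (⟨s, h1, h2, h3⟩ | ⟨-, h⟩)
          · exact ⟨s, h1, by omega, h3⟩
          · exact ⟨n, hn, by omega, h⟩
      have hcompl : (H (n + 1))ᶜ = (H n)ᶜ \ B := by
        rw [hsucc]; ext ω; simp only [Set.mem_compl_iff, Set.mem_union, Set.mem_inter_iff,
          Set.mem_sdiff]; tauto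
      have hm1 : MeasurableSet ((H n)ᶜ ∩ B) := ℱ.le n _ ((hHm n).compl.inter hBm)
      have hreal : μ.real (H (n + 1)) = μ.real (H n) + μ.real ((H n)ᶜ ∩ B) := by
        rw [hsucc, measureReal_union _ hm1]
        exact Set.disjoint_left.mpr fun ω h1 h2 => h2.1 h1
      have h1 : ∫ ω in (H n)ᶜ \ B, N (n + 1) ω ∂μ ≤ ∫ ω in (H n)ᶜ \ B, N n ω ∂μ :=
        hstep n hn _ ((hHm n).compl.diff hBm)
      have h2 : ∫ ω in (H n)ᶜ ∩ B, N n ω ∂μ + ∫ ω in (H n)ᶜ \ B, N n ω ∂μ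
          = ∫ ω in (H n)ᶜ, N n ω ∂μ :=
        integral_inter_add_sdiff (ℱ.le n _ hBm) (hint n hn).integrableOn
      have h3 : θ * μ.real ((H n)ᶜ ∩ B) ≤ ∫ ω in (H n)ᶜ ∩ B, N n ω ∂μ := by
        have := setIntegral_mono_on (μ := μ) (f := fun _ => θ) (g := N n)
          (s := (H n)ᶜ ∩ B) (integrable_const θ).integrableOn (hint n hn).integrableOn hm1
          (fun ω hω => hω.2)
        simpa [mul_comm] using this
      rw [hcompl, hreal]
      linarith
  have h := key n hn
  have h0 : 0 ≤ ∫ ω in (H n)ᶜ, N n ω ∂μ := integral_nonneg fun ω => hnn n ω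
  linarith

namespace PAProcess

variable {p : ℝ} (P : PAProcess p)

instance : MeasurableSpace P.Ω := P.m0

instance : IsProbabilityMeasure P.μ := P.isProb

theorem nv_mono {s t : ℕ} (hs : 1 ≤ s) (hst : s ≤ t) (ω : P.Ω) : P.nv s ω ≤ P.nv t ω := by
  induction t, hst using Nat.le_induction with
  | base => exact le_rfl
  | succ n hn ih => rw [P.nv_succ n (hs.trans hn)]; omega

theorem nv_le {t : ℕ} (ht : 1 ≤ t) (ω : P.Ω) : P.nv t ω ≤ t := by
  induction t, ht using Nat.le_induction with
  | base => rw [P.nv_one]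
  | succ n hn ih => rw [P.nv_succ n hn]; split_ifs <;> omega

theorem ep_le_nv {s : ℕ} (hs : 1 ≤ s) (ω : P.Ω) :
    (P.ep s ω).1 ≤ P.nv s ω ∧ (P.ep s ω).2 ≤ P.nv s ω := by
  rcases Nat.exists_eq_add_of_le hs with ⟨k, rfl⟩
  rcases Nat.eq_zero_or_pos k with rfl | hk
  · simp [P.ep_one, P.nv_one]
  · rw [add_comm 1 k]
    have hnv := P.nv_succ k hk ω
    cases hZ : P.Z (k + 1) ω with
    | true =>
      have := P.ep_vertexStep k hk ω hZ
      simp only [hZ, if_true] at hnv; omega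
    | false =>
      have := P.ep_edgeStep k hk ω hZ
      simp only [hZ] at hnv; simp at hnv; omega

theorem deg_eq_zero {t i : ℕ} {ω : P.Ω} (h : P.nv t ω < i) : P.deg t i ω = 0 := by
  refine (Finset.sum_eq_zero fun s hs => ?_ : (∑ s ∈ Finset.Icc 1 t,
    ((if (P.ep s ω).1 = i then 1 else 0) + (if (P.ep s ω).2 = i then 1 else 0))) = 0)
  rw [Finset.mem_Icc] at hs
  have h1 := P.ep_le_nv hs.1 ω
  have h2 := P.nv_mono hs.1 hs.2 ω
  rw [if_neg (by omega), if_neg (by omega), add_zero]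

theorem deg_zero (i : ℕ) (ω : P.Ω) : P.deg 0 i ω = 0 := by simp [deg, degOf]

theorem deg_succ (t i : ℕ) (ω : P.Ω) : P.deg (t + 1) i ω = P.deg t i ω +
    ((if (P.ep (t + 1) ω).1 = i then 1 else 0) + (if (P.ep (t + 1) ω).2 = i then 1 else 0)) :=
  Finset.sum_Icc_succ_top (by omega) (fun s =>
    ((if (P.ep s ω).1 = i then 1 else 0) + (if (P.ep s ω).2 = i then 1 else 0)))

theorem deg_le (t i : ℕ) (ω : P.Ω) : P.deg t i ω ≤ 2 * t := by
  induction t with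
  | zero => simp [P.deg_zero]
  | succ t ih => rw [P.deg_succ]; split_ifs <;> omega

theorem sum_deg_le (t : ℕ) (S : Finset ℕ) (ω : P.Ω) : ∑ w ∈ S, P.deg t w ω ≤ 2 * t := by
  induction t with
  | zero => simp [P.deg_zero]
  | succ t ih =>
    simp only [P.deg_succ, Finset.sum_add_distrib, Finset.sum_ite_eq]
    split_ifs <;> omega

theorem deg_eq_zero_of_lt {s i : ℕ} (h : s < i) (ω : P.Ω) : P.deg s i ω = 0 := by
  rcases Nat.eq_zero_or_pos s with rfl | hs
  · exact P.deg_zero i ω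
  · exact P.deg_eq_zero ((P.nv_le hs ω).trans_lt h)

theorem deg_self_le {i : ℕ} (hi : 1 ≤ i) (ω : P.Ω) : P.deg i i ω ≤ 2 := by
  obtain ⟨k, rfl⟩ := Nat.exists_eq_add_of_le' hi
  rw [P.deg_succ, P.deg_eq_zero_of_lt (Nat.lt_succ_self k)]
  split_ifs <;> omega

theorem measurable_deg (t i : ℕ) : Measurable[P.ℱ t] (P.deg t i) := by
  change Measurable[P.ℱ t] fun ω => ∑ s ∈ Finset.Icc 1 t,
    ((if (P.ep s ω).1 = i then 1 else 0) + (if (P.ep s ω).2 = i then 1 else 0))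
  refine @Finset.measurable_fun_sum ℕ _ _ _ _ _ (P.ℱ t) _ (Finset.Icc 1 t) fun s hs => ?_
  have hs' := (P.ep_meas s).mono (P.ℱ.mono (Finset.mem_Icc.mp hs).2) le_rfl
  exact (measurable_of_countable (fun x : ℕ × ℕ =>
    (if x.1 = i then 1 else 0) + (if x.2 = i then 1 else 0))).comp hs'

/-- The event that step `t + 1` attaches a new vertex to `u`. -/
def vertexEvent (t u : ℕ) : Set P.Ω :=
  {ω | P.Z (t + 1) ω = true ∧ P.ep (t + 1) ω = (u, P.nv t ω + 1)}

/-- The event that step `t + 1` is an edge-step with ordered endpoints `(u, w)`. -/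
def edgeEvent (t u w : ℕ) : Set P.Ω :=
  {ω | P.Z (t + 1) ω = false ∧ P.ep (t + 1) ω = (u, w)}

theorem measurableSet_vertexEvent (t u : ℕ) : MeasurableSet (P.vertexEvent t u) := by
  have hZ := (P.Z_meas (t + 1)).mono (P.ℱ.le _) le_rfl
  have hep := (P.ep_meas (t + 1)).mono (P.ℱ.le _) le_rfl
  have hnv := (P.nv_meas t).mono (P.ℱ.le _) le_rfl
  exact (hZ (measurableSet_singleton true)).inter
    (measurableSet_eq_fun hep (measurable_const.prodMk (hnv.add_const 1)))

theorem measurableSet_edgeEvent (t u w : ℕ) : MeasurableSet (P.edgeEvent t u w) := by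
  have hZ := (P.Z_meas (t + 1)).mono (P.ℱ.le _) le_rfl
  have hep := (P.ep_meas (t + 1)).mono (P.ℱ.le _) le_rfl
  exact (hZ (measurableSet_singleton false)).inter (hep (measurableSet_singleton (u, w)))

/-- A variable dominating the increment of the degree of `i` at step `t + 1`. -/
noncomputable def incr (t i : ℕ) : P.Ω → ℝ :=
  (P.vertexEvent t i).indicator (fun _ => 1) + ∑ w ∈ Finset.Icc 1 t,
    ((P.edgeEvent t i w).indicator (fun _ => 1) + (P.edgeEvent t w i).indicator (fun _ => 1))

/-- A variable dominating the multiplicative increment of `exp (a * deg)`, with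
`q = exp a - 1`. -/
noncomputable def expIncr (q : ℝ) (t i : ℕ) : P.Ω → ℝ :=
  (fun _ => 1) + (q • P.incr t i + q ^ 2 • (P.edgeEvent t i i).indicator (fun _ => 1))

theorem integrable_incr (t i : ℕ) : Integrable (P.incr t i) P.μ :=
  ((integrable_const 1).indicator (P.measurableSet_vertexEvent t i)).add
    (integrable_finsetSum' _ fun w _ =>
      ((integrable_const 1).indicator (P.measurableSet_edgeEvent t i w)).add
        ((integrable_const 1).indicator (P.measurableSet_edgeEvent t w i)))

theorem integrable_expIncr (q : ℝ) (t i : ℕ) : Integrable (P.expIncr q t i) P.μ :=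
  (integrable_const 1).add (((P.integrable_incr t i).smul q).add
    (((integrable_const 1).indicator (P.measurableSet_edgeEvent t i i)).smul (q ^ 2)))

theorem condExp_incr {t : ℕ} (ht : 1 ≤ t) (i : ℕ) :
    P.μ[P.incr t i | P.ℱ t] =ᵐ[P.μ] fun ω => p * (P.deg t i ω : ℝ) / (2 * t) +
      ∑ w ∈ Finset.Icc 1 t,
        ((1 - p) * (P.deg t i ω : ℝ) * (P.deg t w ω : ℝ) / (2 * t) ^ 2 +
          (1 - p) * (P.deg t w ω : ℝ) * (P.deg t i ω : ℝ) / (2 * t) ^ 2) := by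
  have hiE : ∀ u w, Integrable ((P.edgeEvent t u w).indicator (fun _ => (1 : ℝ))) P.μ :=
    fun u w => (integrable_const 1).indicator (P.measurableSet_edgeEvent t u w)
  have h1 := condExp_add (μ := P.μ)
    ((integrable_const (1 : ℝ)).indicator (P.measurableSet_vertexEvent t i))
    (integrable_finsetSum' (Finset.Icc 1 t) fun w _ => (hiE i w).add (hiE w i)) (P.ℱ t)
  have h2 := condExp_finsetSum (μ := P.μ) (s := Finset.Icc 1 t)
    (fun w _ => (hiE i w).add (hiE w i)) (P.ℱ t)
  have h3 : ∀ᵐ ω ∂P.μ, ∀ w, (P.μ[(P.edgeEvent t i w).indicator (fun _ => (1 : ℝ)) +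
      (P.edgeEvent t w i).indicator (fun _ => (1 : ℝ)) | P.ℱ t]) ω =
      (1 - p) * (P.deg t i ω : ℝ) * (P.deg t w ω : ℝ) / (2 * t) ^ 2 +
          (1 - p) * (P.deg t w ω : ℝ) * (P.deg t i ω : ℝ) / (2 * t) ^ 2 := by
    rw [ae_all_iff]
    intro w
    filter_upwards [condExp_add (hiE i w) (hiE w i) (P.ℱ t), P.condLaw_edge t ht i w,
      P.condLaw_edge t ht w i] with ω e1 e2 e3
    rw [e1]
    exact congrArg₂ (· + ·) e2 e3
  filter_upwards [h1, h2, h3, P.condLaw_vertex t ht i] with ω e1 e2 e3 e4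
  refine e1.trans (congrArg₂ (· + ·) e4 ?_)
  rw [e2, Finset.sum_apply]
  exact Finset.sum_congr rfl fun w _ => e3 w

theorem condExp_expIncr_le (hp0 : 0 < p) (hp1 : p < 1) {q : ℝ} (hq : 0 ≤ q) {t : ℕ} (ht : 1 ≤ t)
    (i : ℕ) : ∀ᵐ ω ∂P.μ, (P.μ[P.expIncr q t i | P.ℱ t]) ω ≤
      1 + ((2 - p) * q + q ^ 2) * ((P.deg t i ω : ℝ) / (2 * t)) := by
  have hiE : Integrable ((P.edgeEvent t i i).indicator (fun _ => (1 : ℝ))) P.μ :=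
    (integrable_const 1).indicator (P.measurableSet_edgeEvent t i i)
  have h1 := condExp_add (μ := P.μ) (integrable_const (1 : ℝ))
    (((P.integrable_incr t i).smul q).add (hiE.smul (q ^ 2))) (P.ℱ t)
  have h2 := condExp_add (μ := P.μ) ((P.integrable_incr t i).smul q) (hiE.smul (q ^ 2)) (P.ℱ t)
  have h3 := condExp_smul (μ := P.μ) q (P.incr t i) (P.ℱ t)
  have h4 := condExp_smul (μ := P.μ) (q ^ 2)
    ((P.edgeEvent t i i).indicator (fun _ => (1 : ℝ))) (P.ℱ t)
  have h5 := condExp_const (μ := P.μ) (P.ℱ.le t) (1 : ℝ)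
  filter_upwards [h1, h2, h3, h4, P.condExp_incr ht i, P.condLaw_edge t ht i i]
    with ω e1 e2 e3 e4 e5 e6
  have ht0 : (0 : ℝ) < 2 * t := by have : (1 : ℝ) ≤ t := by exact_mod_cast ht
                                   linarith
  set x : ℝ := (P.deg t i ω : ℝ) / (2 * t) with hx
  have hx0 : 0 ≤ x := by positivity
  have hx1 : x ≤ 1 := by
    rw [hx, div_le_one ht0]; exact_mod_cast P.deg_le t i ω
  have hsum : (∑ w ∈ Finset.Icc 1 t, (P.deg t w ω : ℝ)) / (2 * t) ≤ 1 := by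
    rw [div_le_one ht0]; exact_mod_cast P.sum_deg_le t _ ω
  have hI : (P.μ[P.incr t i | P.ℱ t]) ω ≤ (2 - p) * x := by
    have : (P.μ[P.incr t i | P.ℱ t]) ω = p * x +
        2 * (1 - p) * x * ((∑ w ∈ Finset.Icc 1 t, (P.deg t w ω : ℝ)) / (2 * t)) := by
      rw [e5, Finset.sum_div, Finset.mul_sum, hx]
      congr 1
      · ring
      · refine Finset.sum_congr rfl fun w _ => ?_
        field_simp
        ring
    rw [this]
    have : 2 * (1 - p) * x * ((∑ w ∈ Finset.Icc 1 t, (P.deg t w ω : ℝ)) / (2 * t)) ≤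
        2 * (1 - p) * x * 1 := by
      apply mul_le_mul_of_nonneg_left hsum
      have : 0 ≤ 1 - p := by linarith
      positivity
    linarith
  have hE : (P.μ[(P.edgeEvent t i i).indicator (fun _ => (1 : ℝ)) | P.ℱ t]) ω ≤ x := by
    have : (P.μ[(P.edgeEvent t i i).indicator (fun _ => (1 : ℝ)) | P.ℱ t]) ω =
        (1 - p) * x * x := by
      refine e6.trans ?_
      simp only [hx, deg]
      field_simp
    rw [this]
    nlinarith [mul_nonneg hx0 (sub_nonneg.mpr hx1), mul_nonneg hp0.le (mul_nonneg hx0 hx0)]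
  have : (P.μ[P.expIncr q t i | P.ℱ t]) ω = 1 + (q * (P.μ[P.incr t i | P.ℱ t]) ω +
      q ^ 2 * (P.μ[(P.edgeEvent t i i).indicator (fun _ => (1 : ℝ)) | P.ℱ t]) ω) := by
    refine e1.trans (congrArg₂ (· + ·) (congrFun h5 ω) (e2.trans (congrArg₂ (· + ·) e3 e4)))
  rw [this]
  nlinarith [mul_le_mul_of_nonneg_left hI hq, mul_le_mul_of_nonneg_left hE (sq_nonneg q)]

theorem indicator_nonneg_apply (A : Set P.Ω) (ω : P.Ω) :
    0 ≤ A.indicator (fun _ => (1 : ℝ)) ω :=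
  Set.indicator_nonneg (fun _ _ => zero_le_one) ω

theorem incr_nonneg (t i : ℕ) (ω : P.Ω) : 0 ≤ P.incr t i ω := by
  simp only [incr, Pi.add_apply, Finset.sum_apply]
  exact add_nonneg (P.indicator_nonneg_apply _ ω) (Finset.sum_nonneg fun w _ =>
    add_nonneg (P.indicator_nonneg_apply _ ω) (P.indicator_nonneg_apply _ ω))

theorem edgeEvent_indicator_le_incr {t i : ℕ} (ω : P.Ω) {w : ℕ} (hw : w ∈ Finset.Icc 1 t) :
    (P.edgeEvent t i w).indicator (fun _ => (1 : ℝ)) ω +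
      (P.edgeEvent t w i).indicator (fun _ => (1 : ℝ)) ω ≤ P.incr t i ω := by
  simp only [incr, Pi.add_apply, Finset.sum_apply]
  have h := Finset.single_le_sum (s := Finset.Icc 1 t)
    (f := fun w => (P.edgeEvent t i w).indicator (fun _ => (1 : ℝ)) ω +
      (P.edgeEvent t w i).indicator (fun _ => (1 : ℝ)) ω)
    (fun w _ => add_nonneg (P.indicator_nonneg_apply _ ω) (P.indicator_nonneg_apply _ ω)) hw
  have h' := P.indicator_nonneg_apply (P.vertexEvent t i) ω
  linarith

theorem vertexEvent_indicator_le_incr (t i : ℕ) (ω : P.Ω) :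
    (P.vertexEvent t i).indicator (fun _ => (1 : ℝ)) ω ≤ P.incr t i ω := by
  simp only [incr, Pi.add_apply, Finset.sum_apply]
  exact le_add_of_nonneg_right (Finset.sum_nonneg fun w _ =>
    add_nonneg (P.indicator_nonneg_apply _ ω) (P.indicator_nonneg_apply _ ω))

theorem expDeg_succ_le_mul_expIncr {a : ℝ} (ha : 0 ≤ a) {t : ℕ} (ht : 1 ≤ t) (i : ℕ) (ω : P.Ω) :
    Real.exp (a * (max (P.deg (t + 1) i ω) 1 : ℕ)) ≤
      Real.exp (a * (max (P.deg t i ω) 1 : ℕ)) * P.expIncr (Real.exp a - 1) t i ω := by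
  set q := Real.exp a - 1 with hq
  have hq0 : 0 ≤ q := by have := Real.add_one_le_exp a; linarith
  have hea : Real.exp a = 1 + q := by rw [hq]; ring
  have hval : P.expIncr q t i ω = 1 + (q * P.incr t i ω +
      q ^ 2 * (P.edgeEvent t i i).indicator (fun _ => (1 : ℝ)) ω) := rfl
  have hI0 := P.incr_nonneg t i ω
  have hE0 := P.indicator_nonneg_apply (P.edgeEvent t i i) ω
  have hge : 1 ≤ P.expIncr q t i ω := by
    rw [hval]
    have := mul_nonneg hq0 hI0
    have := mul_nonneg (sq_nonneg q) hE0
    linarith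
  have key : ∀ k : ℕ, max (P.deg (t + 1) i ω) 1 ≤ max (P.deg t i ω) 1 + k →
      (1 + q) ^ k ≤ P.expIncr q t i ω →
      Real.exp (a * (max (P.deg (t + 1) i ω) 1 : ℕ)) ≤
        Real.exp (a * (max (P.deg t i ω) 1 : ℕ)) * P.expIncr q t i ω := by
    intro k hk hY
    calc Real.exp (a * (max (P.deg (t + 1) i ω) 1 : ℕ))
        ≤ Real.exp (a * ((max (P.deg t i ω) 1 + k : ℕ) : ℝ)) := by
          apply Real.exp_le_exp.mpr
          exact mul_le_mul_of_nonneg_left (by exact_mod_cast hk) ha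
      _ = Real.exp (a * (max (P.deg t i ω) 1 : ℕ)) * (1 + q) ^ k := by
          rw [Nat.cast_add, mul_add, Real.exp_add, ← hea, mul_comm a (k : ℝ), Real.exp_nat_mul]
      _ ≤ _ := mul_le_mul_of_nonneg_left hY (Real.exp_pos _).le
  have hd := P.deg_succ t i ω
  have hnvt := P.nv_le ht ω
  by_cases hi : P.nv t ω < i
  · refine key 0 ?_ (by simpa using hge)
    have h0 := P.deg_eq_zero hi
    have : P.deg (t + 1) i ω ≤ 1 := by
      rw [hd, h0]
      cases hZ : P.Z (t + 1) ω with
      | true =>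
        have := P.ep_vertexStep t ht ω hZ
        rw [if_neg (by omega)]; split_ifs <;> omega
      | false =>
        have := P.ep_edgeStep t ht ω hZ
        rw [if_neg (by omega), if_neg (by omega)]; omega
    omega
  · cases hZ : P.Z (t + 1) ω with
    | true =>
      have hv := P.ep_vertexStep t ht ω hZ
      rw [if_neg (show ¬ (P.ep (t + 1) ω).2 = i by omega)] at hd
      by_cases h1 : (P.ep (t + 1) ω).1 = i
      · rw [if_pos h1] at hd
        refine key 1 (by omega) ?_
        have hmem : ω ∈ P.vertexEvent t i := ⟨hZ, Prod.ext h1 hv.1⟩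
        have hI := P.vertexEvent_indicator_le_incr t i ω
        rw [Set.indicator_of_mem hmem] at hI
        rw [hval]
        nlinarith [mul_le_mul_of_nonneg_left hI hq0, mul_nonneg (sq_nonneg q) hE0]
      · rw [if_neg h1] at hd
        exact key 0 (by omega) (by simpa using hge)
    | false =>
      have hv := P.ep_edgeStep t ht ω hZ
      have hmem : ω ∈ P.edgeEvent t (P.ep (t + 1) ω).1 (P.ep (t + 1) ω).2 := ⟨hZ, rfl⟩
      have hA := P.edgeEvent_indicator_le_incr (i := i) ω
        (Finset.mem_Icc.mpr ⟨hv.1, hv.2.1.trans hnvt⟩)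
      have hB := P.edgeEvent_indicator_le_incr (i := i) ω
        (Finset.mem_Icc.mpr ⟨hv.2.2.1, hv.2.2.2.trans hnvt⟩)
      by_cases h1 : (P.ep (t + 1) ω).1 = i <;> by_cases h2 : (P.ep (t + 1) ω).2 = i
      · rw [if_pos h1, if_pos h2] at hd
        refine key 2 (by omega) ?_
        rw [h1, h2] at hmem
        rw [h1, Set.indicator_of_mem hmem] at hA
        rw [hval, Set.indicator_of_mem hmem]
        nlinarith [mul_le_mul_of_nonneg_left hA hq0]
      · rw [if_pos h1, if_neg h2] at hd
        refine key 1 (by omega) ?_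
        rw [h1] at hmem
        rw [Set.indicator_of_mem hmem] at hB
        have := P.indicator_nonneg_apply (P.edgeEvent t (P.ep (t + 1) ω).2 i) ω
        have hI : 1 ≤ P.incr t i ω := by linarith
        rw [hval]
        nlinarith [mul_le_mul_of_nonneg_left hI hq0, mul_nonneg (sq_nonneg q) hE0]
      · rw [if_neg h1, if_pos h2] at hd
        refine key 1 (by omega) ?_
        rw [h2] at hmem
        rw [Set.indicator_of_mem hmem] at hA
        have := P.indicator_nonneg_apply (P.edgeEvent t i (P.ep (t + 1) ω).1) ω
        have hI : 1 ≤ P.incr t i ω := by linarith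
        rw [hval]
        nlinarith [mul_le_mul_of_nonneg_left hI hq0, mul_nonneg (sq_nonneg q) hE0]
      · rw [if_neg h1, if_neg h2] at hd
        exact key 0 (by omega) (by simpa using hge)

/-- The exponential of the degree of `i`, frozen at one before `i` is born. -/
noncomputable def expDeg (a : ℝ) (t i : ℕ) (ω : P.Ω) : ℝ :=
  Real.exp (a * (max (P.deg t i ω) 1 : ℕ))

theorem measurable_expDeg (a : ℝ) (t i : ℕ) : Measurable[P.ℱ t] (P.expDeg a t i) :=
  (measurable_of_countable (fun n : ℕ => Real.exp (a * (max n 1 : ℕ)))).comp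
    (P.measurable_deg t i)

theorem norm_expDeg_le {a : ℝ} (ha : 0 ≤ a) (t i : ℕ) (ω : P.Ω) :
    ‖P.expDeg a t i ω‖ ≤ Real.exp (a * (2 * t + 1 : ℕ)) := by
  rw [expDeg, Real.norm_eq_abs, Real.abs_exp, Real.exp_le_exp]
  refine mul_le_mul_of_nonneg_left ?_ ha
  have := P.deg_le t i ω
  exact_mod_cast (show max (P.deg t i ω) 1 ≤ 2 * t + 1 by omega)

theorem integrable_expDeg {a : ℝ} (ha : 0 ≤ a) (t i : ℕ) : Integrable (P.expDeg a t i) P.μ :=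
  Integrable.of_bound ((P.measurable_expDeg a t i).mono (P.ℱ.le t) le_rfl).aestronglyMeasurable
    _ (Eventually.of_forall (P.norm_expDeg_le ha t i))

theorem setIntegral_expDeg_succ_le (hp0 : 0 < p) (hp1 : p < 1) {a b : ℝ} (ha : 0 ≤ a)
    (ha1 : a ≤ 1) {t : ℕ} (ht : 1 ≤ t)
    (hab : a + ((1 - p / 2) * a + 3 * a ^ 2) / t ≤ b) (i : ℕ)
    {A : Set P.Ω} (hA : MeasurableSet[P.ℱ t] A) :
    ∫ ω in A, P.expDeg a (t + 1) i ω ∂P.μ ≤ ∫ ω in A, P.expDeg b t i ω ∂P.μ := by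
  set q := Real.exp a - 1 with hq
  have hq0 : 0 ≤ q := by have := Real.add_one_le_exp a; linarith
  have hq1 : q ≤ a + a ^ 2 := by
    have := (abs_le.mp (Real.abs_exp_sub_one_sub_id_le (x := a) (by rwa [abs_of_nonneg ha]))).2
    linarith
  have ht0 : (1 : ℝ) ≤ t := by exact_mod_cast ht
  have hb : 0 ≤ b := by
    refine le_trans ?_ hab
    have : 0 ≤ 1 - p / 2 := by linarith
    positivity
  have hsm := (P.measurable_expDeg a t i).stronglyMeasurable
  have hY := P.integrable_expIncr q t i
  have hGY : Integrable (P.expDeg a t i * P.expIncr q t i) P.μ :=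
    hY.bdd_mul (hsm.mono (P.ℱ.le t)).aestronglyMeasurable
      (Eventually.of_forall (P.norm_expDeg_le ha t i))
  calc ∫ ω in A, P.expDeg a (t + 1) i ω ∂P.μ
      ≤ ∫ ω in A, (P.expDeg a t i * P.expIncr q t i) ω ∂P.μ :=
        setIntegral_mono (P.integrable_expDeg ha _ i).integrableOn hGY.integrableOn
          (P.expDeg_succ_le_mul_expIncr ha ht i)
    _ = ∫ ω in A, (P.μ[P.expDeg a t i * P.expIncr q t i | P.ℱ t]) ω ∂P.μ :=
        (setIntegral_condExp (P.ℱ.le t) hGY hA).symm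
    _ ≤ ∫ ω in A, P.expDeg b t i ω ∂P.μ := by
        refine setIntegral_mono_ae integrable_condExp.integrableOn
          (P.integrable_expDeg hb t i).integrableOn ?_
        filter_upwards [condExp_mul_of_stronglyMeasurable_left hsm hGY hY,
          P.condExp_expIncr_le hp0 hp1 hq0 ht i] with ω e1 e2
        rw [e1, Pi.mul_apply]
        set D : ℕ := max (P.deg t i ω) 1 with hD
        have hdD : (P.deg t i ω : ℝ) ≤ D := by exact_mod_cast le_max_left _ _
        have hcoef : (2 - p) * q + q ^ 2 ≤ 2 * ((1 - p / 2) * a + 3 * a ^ 2) := by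
          have h2 : q ≤ 2 * a := by nlinarith
          have h3 : q ^ 2 ≤ (2 * a) ^ 2 := pow_le_pow_left₀ hq0 h2 2
          nlinarith [mul_le_mul_of_nonneg_left hq1 (show 0 ≤ 2 - p by linarith),
            mul_nonneg hp0.le (sq_nonneg a)]
        have hle : 1 + ((2 - p) * q + q ^ 2) * ((P.deg t i ω : ℝ) / (2 * t)) ≤
            Real.exp (((1 - p / 2) * a + 3 * a ^ 2) / t * D) := by
          have h1 : ((2 - p) * q + q ^ 2) * ((P.deg t i ω : ℝ) / (2 * t)) ≤
              2 * ((1 - p / 2) * a + 3 * a ^ 2) * ((D : ℝ) / (2 * t)) := by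
            refine mul_le_mul hcoef (by gcongr) (by positivity) ?_
            have : 0 ≤ 1 - p / 2 := by linarith
            positivity
          have h2 : 2 * ((1 - p / 2) * a + 3 * a ^ 2) * ((D : ℝ) / (2 * t)) =
              ((1 - p / 2) * a + 3 * a ^ 2) / t * D := by field_simp
          have := Real.add_one_le_exp (((1 - p / 2) * a + 3 * a ^ 2) / t * D)
          linarith
        calc P.expDeg a t i ω * (P.μ[P.expIncr q t i | P.ℱ t]) ω
            ≤ Real.exp (a * D) * Real.exp (((1 - p / 2) * a + 3 * a ^ 2) / t * D) :=
              mul_le_mul_of_nonneg_left (e2.trans hle) (Real.exp_pos _).le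
          _ = Real.exp ((a + ((1 - p / 2) * a + 3 * a ^ 2) / t) * D) := by
              rw [← Real.exp_add]; ring_nf
          _ ≤ Real.exp (b * D) :=
              Real.exp_le_exp.mpr (mul_le_mul_of_nonneg_right hab (Nat.cast_nonneg D))

end PAProcess

theorem phi_succ (c : ℝ) {t : ℕ} (ht : 1 ≤ t) : phi c (t + 1) = phi c t * (1 + c / t) := by
  obtain ⟨k, rfl⟩ := Nat.exists_eq_add_of_le' ht
  exact Finset.prod_Icc_succ_top (by omega) _

theorem phi_pos {c : ℝ} (hc : 0 ≤ c) (t : ℕ) : 0 < phi c t :=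
  Finset.prod_pos fun s _ => by positivity

theorem phi_mono {c : ℝ} (hc : 0 ≤ c) {s t : ℕ} (hs : 1 ≤ s) (hst : s ≤ t) :
    phi c s ≤ phi c t := by
  induction t, hst using Nat.le_induction with
  | base => exact le_rfl
  | succ n hn ih =>
    rw [phi_succ c (hs.trans hn)]
    refine ih.trans (le_mul_of_one_le_right (phi_pos hc n).le ?_)
    have : 0 ≤ c / n := by positivity
    linarith

theorem rpow_le_phi {c : ℝ} (hc : 0 ≤ c) (hc1 : c ≤ 1) {t : ℕ} (ht : 1 ≤ t) :
    (t : ℝ) ^ c ≤ phi c t := by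
  induction t, ht using Nat.le_induction with
  | base => simp [phi]
  | succ n hn ih =>
    have hn0 : (0 : ℝ) < n := by exact_mod_cast hn
    have h1 : ((n + 1 : ℕ) : ℝ) = n * (1 + 1 / n) := by push_cast; field_simp
    have h2 : (1 + 1 / (n : ℝ)) ^ c ≤ 1 + c * (1 / n) :=
      rpow_one_add_le_one_add_mul_self (by have : 0 ≤ 1 / (n : ℝ) := by positivity
                                           linarith) hc hc1
    rw [phi_succ c hn, h1, Real.mul_rpow hn0.le (by positivity)]
    refine mul_le_mul ih (h2.trans_eq (by ring)) (by positivity) (phi_pos hc n).le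

/-- The exponent used at time `t` in the exponential supermartingale attached to vertex `i`. -/
noncomputable def tiltExponent (c : ℝ) (i t : ℕ) : ℝ :=
  c * phi c i / 12 * (1 + phi c i / phi c t) / phi c t

theorem tiltExponent_nonneg {c : ℝ} (hc : 0 ≤ c) (i t : ℕ) : 0 ≤ tiltExponent c i t := by
  have := phi_pos hc i
  have := phi_pos hc t
  unfold tiltExponent
  positivity

theorem tiltExponent_self {c : ℝ} (hc : 0 ≤ c) (i : ℕ) : tiltExponent c i i = c / 6 := by
  have := phi_pos hc i
  unfold tiltExponent
  field_simp
  ring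

theorem tiltExponent_le {c : ℝ} (hc : 0 ≤ c) {i t : ℕ} (hi : 1 ≤ i) (hit : i ≤ t) :
    tiltExponent c i t ≤ c / 6 := by
  rw [← tiltExponent_self hc i]
  have := phi_pos hc i
  have := phi_mono hc hi hit
  unfold tiltExponent
  gcongr

theorem le_tiltExponent {c : ℝ} (hc : 0 ≤ c) (i t : ℕ) :
    c * phi c i / 12 / phi c t ≤ tiltExponent c i t := by
  have := phi_pos hc i
  have := phi_pos hc t
  unfold tiltExponent
  gcongr
  refine le_mul_of_one_le_right (by positivity) ?_
  have : 0 ≤ phi c i / phi c t := by positivity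
  linarith

theorem tiltExponent_step {c : ℝ} (hc : 0 < c) {i t : ℕ} (hi : 1 ≤ i) (hit : i ≤ t) :
    tiltExponent c i (t + 1) +
      (c * tiltExponent c i (t + 1) + 3 * tiltExponent c i (t + 1) ^ 2) / t ≤
        tiltExponent c i t := by
  have ht : (0 : ℝ) < t := by exact_mod_cast hi.trans hit
  have hi0 := phi_pos hc.le i
  have ht0 := phi_pos hc.le t
  have him := phi_mono hc.le hi hit
  have hs := phi_succ c (hi.trans hit)
  unfold tiltExponent
  rw [hs]
  set F := phi c i
  set f := phi c t
  set r : ℝ := c / t with hr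
  have hr0 : 0 < r := by positivity
  have hrt : 1 / (t : ℝ) = r / c := by rw [hr]; field_simp
  set g := F / f with hg
  have hg0 : 0 < g := by positivity
  have hg1 : g ≤ 1 := by rw [hg, div_le_one ht0]; exact him
  have e1 : c * F / 12 * (1 + F / (f * (1 + r))) / (f * (1 + r)) =
      c / 12 * g * (1 + g / (1 + r)) / (1 + r) := by rw [hg]; field_simp
  have e2 : c * F / 12 * (1 + g) / f = c / 12 * g * (1 + g) := by rw [hg]; field_simp
  rw [e1, e2]
  set u : ℝ := (1 + g / (1 + r)) with hu
  have hu2 : u ≤ 2 := by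
    have : g / (1 + r) ≤ 1 := by rw [div_le_one (by linarith)]; linarith
    linarith
  have hu0 : 0 < u := by positivity
  have e3 : c / 12 * g * u / (1 + r) + (c * (c / 12 * g * u / (1 + r)) +
      3 * (c / 12 * g * u / (1 + r)) ^ 2) / t =
      c / 12 * g * (u + r * g * (u ^ 2) / (4 * (1 + r) ^ 2)) := by
    rw [div_eq_mul_one_div _ (t : ℝ), hrt]
    field_simp
    ring
  rw [e3]
  have h4 : u + r * g * u ^ 2 / (4 * (1 + r) ^ 2) ≤ 1 + g := by
    have hu4 : u ^ 2 ≤ 4 := by nlinarith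
    have : r * g * u ^ 2 / (4 * (1 + r) ^ 2) ≤ r * g / (1 + r) := by
      rw [div_le_div_iff₀ (by positivity) (by positivity)]
      have h5 : r * g * u ^ 2 * (1 + r) ≤ r * g * 4 * (1 + r) := by gcongr
      have h6 : r * g * 4 * (1 + r) ≤ r * g * 4 * (1 + r) ^ 2 := by
        gcongr; nlinarith
      linarith
    have h7 : g / (1 + r) + r * g / (1 + r) = g := by field_simp
    linarith
  gcongr

/-- **Theorem (Upper bound for the degree).**
For `p ∈ (0,1)` and `c_p = 1 - p/2` there are positive constants `C₁, C₂` (depending only on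
`p`) such that for every vertex `i ≥ 1` and every `λ > i^{-c_p}`,
`P(sup_{s ∈ ℕ} d_s(i)/φ(s) > λ / i^{c_p}) ≤ C₁ exp(-C₂ λ)`. -/
theorem degree_sup_upper_bound (p : ℝ) (hp0 : 0 < p) (hp1 : p < 1)
    (P : PAProcess p) :
    ∃ C₁ C₂ : ℝ, 0 < C₁ ∧ 0 < C₂ ∧
      ∀ i : ℕ, 1 ≤ i → ∀ lam : ℝ, (i : ℝ) ^ (-(1 - p / 2)) < lam →
        (P.μ {ω | ∃ s : ℕ, 1 ≤ s ∧
            lam / (i : ℝ) ^ (1 - p / 2) < (P.deg s i ω : ℝ) / phi (1 - p / 2) s}).toReal ≤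
          C₁ * Real.exp (-C₂ * lam) := by
  set c : ℝ := 1 - p / 2 with hcdef
  have hc : 0 < c := by linarith
  have hc1 : c ≤ 1 := by linarith
  refine ⟨Real.exp (c / 3), c / 12, Real.exp_pos _, by positivity, fun i hi lam hlam => ?_⟩
  have hi0 : (0 : ℝ) < i := by exact_mod_cast hi
  have hic : 0 < (i : ℝ) ^ c := Real.rpow_pos_of_pos hi0 _
  have hlam0 : 0 < lam := lt_trans (Real.rpow_pos_of_pos hi0 _) hlam
  set N : ℕ → P.Ω → ℝ := fun t => P.expDeg (tiltExponent c i t) t i with hN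
  set θ : ℝ := Real.exp (c / 12 * lam) with hθ
  set H : ℕ → Set P.Ω := fun n => {ω | ∃ s, i ≤ s ∧ s < n ∧ θ ≤ N s ω} with hH
  have hinit : ∫ ω, N i ω ∂P.μ ≤ Real.exp (c / 3) := by
    have hle : ∀ ω, N i ω ≤ Real.exp (c / 3) := by
      intro ω
      simp only [hN, PAProcess.expDeg, Real.exp_le_exp, tiltExponent_self hc.le]
      have h2 : ((max (P.deg i i ω) 1 : ℕ) : ℝ) ≤ 2 := by
        have := P.deg_self_le hi ω
        exact_mod_cast (show max (P.deg i i ω) 1 ≤ 2 by omega)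
      nlinarith
    calc ∫ ω, N i ω ∂P.μ ≤ ∫ _, Real.exp (c / 3) ∂P.μ :=
          integral_mono (P.integrable_expDeg (tiltExponent_nonneg hc.le i i) i i)
            (integrable_const _) hle
      _ = Real.exp (c / 3) := by simp
  have hbound : ∀ n, i ≤ n → θ * P.μ.real (H n) ≤ Real.exp (c / 3) :=
    mul_measureReal_exists_ge_le P.ℱ N i θ _
      (fun n _ => P.measurable_expDeg _ n i) (fun n ω => (Real.exp_pos _).le)
      (fun n _ => P.integrable_expDeg (tiltExponent_nonneg hc.le i n) n i)
      (fun n hn A hA => P.setIntegral_expDeg_succ_le hp0 hp1 (tiltExponent_nonneg hc.le i (n + 1))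
        (by have := tiltExponent_le hc.le hi (hn.trans n.le_succ); linarith) (hi.trans hn)
        (tiltExponent_step hc hi hn) i hA) hinit
  have hmono : Monotone H := by
    rintro m n hmn ω ⟨s, h1, h2, h3⟩
    exact ⟨s, h1, h2.trans_le hmn, h3⟩
  have hsub : {ω | ∃ s : ℕ, 1 ≤ s ∧
      lam / (i : ℝ) ^ c < (P.deg s i ω : ℝ) / phi c s} ⊆ ⋃ n, H n := by
    rintro ω ⟨s, hs, hlt⟩
    have hpos : 0 < lam / (i : ℝ) ^ c := by positivity
    have his : i ≤ s := by
      by_contra hsi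
      rw [P.deg_eq_zero_of_lt (not_le.mp hsi) ω] at hlt
      simp only [Nat.cast_zero, zero_div] at hlt
      linarith
    refine Set.mem_iUnion.mpr ⟨s + 1, s, his, s.lt_succ_self, ?_⟩
    simp only [hθ, hN, PAProcess.expDeg, Real.exp_le_exp]
    have hphi := phi_pos hc.le s
    have hphii := phi_pos hc.le i
    have hD : (P.deg s i ω : ℝ) ≤ ((max (P.deg s i ω) 1 : ℕ) : ℝ) := by
      exact_mod_cast le_max_left _ _
    calc c / 12 * lam = c * (i : ℝ) ^ c / 12 * (lam / (i : ℝ) ^ c) := by field_simp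
      _ ≤ c * phi c i / 12 * ((P.deg s i ω : ℝ) / phi c s) := by
          have := rpow_le_phi hc.le hc1 hi
          gcongr
      _ = c * phi c i / 12 / phi c s * (P.deg s i ω : ℝ) := by ring
      _ ≤ _ := mul_le_mul (le_tiltExponent hc.le i s) hD (Nat.cast_nonneg _)
          (tiltExponent_nonneg hc.le i s)
  have hH_le : ∀ n, P.μ (H n) ≤ ENNReal.ofReal (Real.exp (c / 3) * Real.exp (-(c / 12) * lam)) := by
    intro n
    refine (measure_mono (hmono (le_max_left n i))).trans ?_
    have h := hbound (max n i) (le_max_right _ _)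
    rw [← ofReal_measureReal]
    refine ENNReal.ofReal_le_ofReal ?_
    rw [neg_mul, Real.exp_neg, ← div_eq_mul_inv, le_div_iff₀ (Real.exp_pos _), mul_comm]
    exact h
  refine ENNReal.toReal_le_of_le_ofReal (by positivity) ((measure_mono hsub).trans ?_)
  rw [hmono.measure_iUnion]
  exact iSup_le hH_le
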